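/- If G is a planar chordal graph that is not a complete graph, then b(G) ≤ 4. -/

import Mathlib

open SimpleGraph

section Defs
variable {V : Type*}

/-- `S` is a dominating set of `G`. -/
def Dominates (G : SimpleGraph V) (S : Set V) : Prop :=
  ∀ v : V, v ∈ S ∨ ∃ u ∈ S, G.Adj u v

/-- The domination number `γ(G)`. -/
noncomputable def domNum (G : SimpleGraph V) [Fintype V] : ℕ :=
  sInf {n | ∃ S : Finset V, S.card = n ∧ Dominates G ↑S}

/-- The bondage number `b(G)`. -/
noncomputable def bondageNum (G : SimpleGraph V) [Fintype V] : ℕ :=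
  sInf {n | ∃ A : Finset (Sym2 V), ↑A ⊆ G.edgeSet ∧ A.card = n ∧
    domNum (G.deleteEdges ↑A) = domNum G + 1}

/-- The clique number `ω(G)`. -/
noncomputable def cliqueNum' (G : SimpleGraph V) [Fintype V] : ℕ :=
  sSup {n | ∃ s : Finset V, G.IsNClique n s}

/-- The degree of a vertex. -/
noncomputable def vdeg (G : SimpleGraph V) (v : V) : ℕ := (G.neighborSet v).ncard

/-- The maximum degree `Δ(G)`. -/
noncomputable def maxDeg (G : SimpleGraph V) [Fintype V] : ℕ :=
  sSup {d | ∃ v, vdeg G v = d}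

/-- A chordal graph: no induced cycle of length at least 4. -/
def Chordal (G : SimpleGraph V) : Prop :=
  ∀ n, 4 ≤ n → IsEmpty (cycleGraph n ↪g G)

/-- The corona `G ∘ K₁`: attach a pendant vertex to each vertex of `G`. -/
def coronaK1 (G : SimpleGraph V) : SimpleGraph (V ⊕ V) :=
  SimpleGraph.fromRel (fun a b =>
    (∃ u v, a = Sum.inl u ∧ b = Sum.inl v ∧ G.Adj u v) ∨
    (∃ u, a = Sum.inl u ∧ b = Sum.inr u))

end Defs

/-- `z` is a simplicial vertex of `G`. -/
def SimplV {V : Type*} (G : SimpleGraph V) (z : V) : Prop :=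
  ∀ a b, G.Adj z a → G.Adj z b → a ≠ b → G.Adj a b

/-- `G` restricted to the edges inside `U`. -/
def restr {V : Type*} (G : SimpleGraph V) (U : Set V) : SimpleGraph V where
  Adj a b := G.Adj a b ∧ a ∈ U ∧ b ∈ U
  symm := ⟨fun _ _ h => ⟨h.1.symm, h.2.2, h.2.1⟩⟩
  loopless := ⟨fun a h => G.loopless.irrefl a h.1⟩

/-- Two non-adjacent neighbours `s, t` of `x` joined through `U`, whose vertices are
not neighbours of `x`, give an induced cycle. -/
theorem no_bypass {V : Type*} (G : SimpleGraph V) (hch : Chordal G) (U : Set V) (x s t : V)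
    (hU : ∀ a ∈ U, a ≠ x ∧ ¬ G.Adj x a) (hs : G.Adj x s) (ht : G.Adj x t) (hst : s ≠ t)
    (hn : ¬ G.Adj s t) (hr : (restr G (U ∪ {s, t})).Reachable s t) : False := by
  classical
  set H := restr G (U ∪ {s, t}) with hH
  obtain ⟨p, hp⟩ := hr.exists_walk_length_eq_dist
  have hmin : ∀ q : H.Walk s t, p.length ≤ q.length := fun q => hp.trans_le (SimpleGraph.dist_le q)
  set n := p.length with hnlen
  have hinj : ∀ i j, i ≤ n → j ≤ n → i < j → p.getVert i ≠ p.getVert j := by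
    intro i j hi hj hij he
    have h1 := hmin ((p.take i).append ((p.drop j).copy he.symm rfl))
    simp [SimpleGraph.Walk.length_append, SimpleGraph.Walk.take_length,
      SimpleGraph.Walk.drop_length] at h1
    omega
  have hadj : ∀ i j, i ≤ n → j ≤ n → i < j → H.Adj (p.getVert i) (p.getVert j) → j = i + 1 := by
    intro i j hi hj hij he
    have h1 := hmin ((p.take i).append (SimpleGraph.Walk.cons he (p.drop j)))
    simp [SimpleGraph.Walk.length_append, SimpleGraph.Walk.take_length,
      SimpleGraph.Walk.drop_length] at h1
    omega
  have hsucc : ∀ i, i < n → H.Adj (p.getVert i) (p.getVert (i+1)) :=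
    fun i hi => p.adj_getVert_succ hi
  have h0 : p.getVert 0 = s := p.getVert_zero
  have hl : p.getVert n = t := p.getVert_length
  have hn0 : n ≠ 0 := fun h => hst (h0.symm.trans ((congrArg p.getVert h.symm).trans hl))
  have hn1 : n ≠ 1 := fun h => hn (by
    have := hsucc 0 (by omega)
    rw [h0] at this
    have h3 : p.getVert (0+1) = t := (congrArg p.getVert h.symm).trans hl
    rw [h3] at this
    exact this.1)
  have hmem : ∀ i, i ≤ n → p.getVert i ∈ U ∪ {s, t} := by
    intro i hi
    rcases Nat.lt_or_ge i n with h | h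
    · exact (hsucc i h).2.1
    · have : i = n := by omega
      rw [this, hl]; simp
  have hmid : ∀ i, 0 < i → i < n → p.getVert i ∈ U := by
    intro i hi hi'
    rcases hmem i hi'.le with h | h | h
    · exact h
    · exact absurd (h0.trans h.symm) (hinj 0 i (by omega) hi'.le hi)
    · exact absurd (Eq.trans h hl.symm) (hinj i n hi'.le le_rfl hi')
  have hxne : ∀ i, i ≤ n → p.getVert i ≠ x := by
    intro i hi h
    rcases hmem i hi with h' | h' | h'
    · exact (hU _ h').1 h
    · rw [h] at h'; exact hs.ne h'
    · rw [h] at h'; exact ht.ne h'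
  have hGH : ∀ i j, i ≤ n → j ≤ n → G.Adj (p.getVert i) (p.getVert j) →
      H.Adj (p.getVert i) (p.getVert j) := fun i j hi hj h => ⟨h, hmem i hi, hmem j hj⟩
  -- characterise adjacency for ordered pairs
  have key : ∀ i j, i < j → j ≤ n → (G.Adj (p.getVert i) (p.getVert j) ↔ j = i + 1) := by
    intro i j hij hj
    constructor
    · intro h
      exact hadj i j (by omega) hj hij (hGH i j (by omega) hj h)
    · rintro rfl
      exact (hsucc i (by omega)).1
  have keyx : ∀ i, i ≤ n → (G.Adj (p.getVert i) x ↔ i = 0 ∨ i = n) := by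
    intro i hi
    constructor
    · intro h
      by_contra hc
      exact (hU _ (hmid i (by omega) (by omega))).2 h.symm
    · rintro (rfl | rfl)
      · rw [h0]; exact hs.symm
      · rw [hl]; exact ht.symm
  let f : Fin (n + 2) → V := fun i => if i.1 ≤ n then p.getVert i.1 else x
  have hlt : ∀ i j : Fin (n+2), i < j → f i ≠ f j ∧
      (G.Adj (f i) (f j) ↔ (cycleGraph (n+2)).Adj i j) := by
    intro i j hij
    have hij' : i.1 < j.1 := hij
    have hjl := j.2
    have hcyc : (cycleGraph (n+2)).Adj i j ↔ (j.1 = i.1 + 1 ∨ (i.1 = 0 ∧ j.1 = n + 1)) := by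
      rw [SimpleGraph.cycleGraph_adj']
      rw [Fin.coe_sub_iff_lt.2 hij, Fin.coe_sub_iff_le.2 hij.le]
      omega
    rw [hcyc]
    by_cases hj : j.1 ≤ n
    · have hi : i.1 ≤ n := by omega
      simp only [f, if_pos hi, if_pos hj]
      refine ⟨hinj _ _ hi hj hij', ?_⟩
      rw [key _ _ hij' hj]
      omega
    · have hi : i.1 ≤ n := by omega
      simp only [f, if_pos hi, if_neg hj]
      refine ⟨hxne _ hi, ?_⟩
      rw [keyx _ hi]
      omega
  refine (hch (n+2) (by omega)).false ⟨⟨f, ?_⟩, ?_⟩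
  · intro i j h
    rcases lt_trichotomy i j with h' | h' | h'
    · exact absurd h (hlt i j h').1
    · exact h'
    · exact absurd h.symm (hlt j i h').1
  · intro i j
    change G.Adj (f i) (f j) ↔ _
    rcases lt_trichotomy i j with h' | h' | h'
    · exact (hlt i j h').2
    · subst h'; simp
    · rw [G.adj_comm, (cycleGraph (n+2)).adj_comm]; exact (hlt j i h').2

/-- Dirac: outside any proper clique of a chordal graph there is a simplicial vertex. -/
theorem dirac {V : Type*} [Fintype V] (G : SimpleGraph V) (hch : Chordal G) :
    ∀ (n : ℕ) (W K : Finset V), W.card = n → K ⊆ W → (∃ c ∈ W, c ∉ K) →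
      (∀ a ∈ K, ∀ b ∈ K, a ≠ b → G.Adj a b) →
      ∃ z ∈ W, z ∉ K ∧ ∀ a ∈ W, ∀ b ∈ W, G.Adj z a → G.Adj z b → a ≠ b → G.Adj a b := by
  classical
  intro n
  induction n using Nat.strong_induction_on with
  | _ n ih =>
  intro W K hW hKW hc hK
  by_cases hcomp : ∀ a ∈ W, ∀ b ∈ W, a ≠ b → G.Adj a b
  · obtain ⟨c, hcW, hcK⟩ := hc
    exact ⟨c, hcW, hcK, fun a ha b hb _ _ hab => hcomp a ha b hb hab⟩
  -- a non-universal vertex whose closed neighbourhood contains the clique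
  have hx : ∃ x ∈ W, (∃ c0 ∈ W, c0 ≠ x ∧ ¬ G.Adj x c0) ∧ ∀ k ∈ K, k = x ∨ G.Adj x k := by
    by_cases h : ∃ x ∈ K, ∃ c0 ∈ W, c0 ≠ x ∧ ¬ G.Adj x c0
    · obtain ⟨x, hxK, h2⟩ := h
      refine ⟨x, hKW hxK, h2, fun k hk => ?_⟩
      by_cases hkx : k = x
      · exact Or.inl hkx
      · exact Or.inr (hK x hxK k hk (Ne.symm hkx))
    · push Not at h hcomp
      obtain ⟨a, ha, b, hb, hab, hnab⟩ := hcomp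
      refine ⟨a, ha, ⟨b, hb, hab.symm, hnab⟩, fun k hk => ?_⟩
      by_cases hka : k = a
      · exact Or.inl hka
      · exact Or.inr (h k hk a ha (Ne.symm hka)).symm
  obtain ⟨x, hxW, ⟨c0, hc0W, hc0x, hc0n⟩, hKx⟩ := hx
  let U : Set V := {a | a ∈ W ∧ a ≠ x ∧ ¬ G.Adj x a}
  let C : Finset V := W.filter (fun a => a ∈ U ∧ (restr G U).Reachable c0 a)
  let S : Finset V := W.filter (fun a => a ∉ C ∧ ∃ c ∈ C, G.Adj a c)
  have hCU : ∀ c ∈ C, c ∈ U := fun c h => (Finset.mem_filter.1 h).2.1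
  have hCr : ∀ c ∈ C, (restr G U).Reachable c0 c := fun c h => (Finset.mem_filter.1 h).2.2
  have hc0C : c0 ∈ C :=
    Finset.mem_filter.2 ⟨hc0W, ⟨hc0W, hc0x, hc0n⟩, SimpleGraph.Reachable.refl _⟩
  have hSx : ∀ s ∈ S, G.Adj x s := by
    intro s hs
    obtain ⟨hsW, hsC, c, hc, hsc⟩ := Finset.mem_filter.1 hs
    by_contra hxs
    have hsx : s ≠ x := by
      rintro rfl
      exact (hCU c hc).2.2 hsc
    have hsU : s ∈ U := ⟨hsW, hsx, hxs⟩
    apply hsC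
    refine Finset.mem_filter.2 ⟨hsW, hsU, (hCr c hc).trans ?_⟩
    exact SimpleGraph.Adj.reachable (⟨hsc.symm, hCU c hc, hsU⟩ : (restr G U).Adj c s)
  have hScl : ∀ a ∈ S, ∀ b ∈ S, a ≠ b → G.Adj a b := by
    intro s hs t ht hst
    by_contra hn
    obtain ⟨hsW, hsC, c, hc, hsc⟩ := Finset.mem_filter.1 hs
    obtain ⟨htW, htC, d, hd, htd⟩ := Finset.mem_filter.1 ht
    refine no_bypass G hch U x s t (fun a ha => ha.2) (hSx s hs) (hSx t ht) hst hn ?_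
    have hle : restr G U ≤ restr G (U ∪ {s, t}) :=
      fun a b h => ⟨h.1, Or.inl h.2.1, Or.inl h.2.2⟩
    have h1 : (restr G (U ∪ {s, t})).Adj s c :=
      ⟨hsc, Or.inr (by simp), Or.inl (hCU c hc)⟩
    have h2 : (restr G (U ∪ {s, t})).Adj d t :=
      ⟨htd.symm, Or.inl (hCU d hd), Or.inr (by simp)⟩
    exact h1.reachable.trans ((((hCr c hc).symm.trans (hCr d hd)).mono hle).trans h2.reachable)
  have hsub : C ∪ S ⊆ W := by
    intro a ha
    rcases Finset.mem_union.1 ha with h | h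
    · exact (Finset.mem_filter.1 h).1
    · exact (Finset.mem_filter.1 h).1
  have hxn : x ∉ C ∪ S := by
    intro h
    rcases Finset.mem_union.1 h with h | h
    · exact (hCU x h).2.1 rfl
    · exact (hSx x h).ne rfl
  have hcard : (C ∪ S).card < n := by
    rw [← hW]
    exact Finset.card_lt_card ⟨hsub, fun h => hxn (h hxW)⟩
  obtain ⟨z, hz, hzS, hzs⟩ := ih _ hcard (C ∪ S) S rfl Finset.subset_union_right
    ⟨c0, Finset.mem_union_left _ hc0C, fun h => (Finset.mem_filter.1 h).2.1 hc0C⟩ hScl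
  have hzC : z ∈ C := (Finset.mem_union.1 hz).resolve_right hzS
  have hnb : ∀ a ∈ W, G.Adj z a → a ∈ C ∪ S := by
    intro a ha hza
    by_cases h : a ∈ C
    · exact Finset.mem_union_left _ h
    · exact Finset.mem_union_right _ (Finset.mem_filter.2 ⟨ha, h, z, hzC, hza.symm⟩)
  refine ⟨z, hsub hz, ?_, fun a ha b hb hza hzb => hzs a (hnb a ha hza) b (hnb b hb hzb) hza hzb⟩
  intro hzK
  have := hCU z hzC
  rcases hKx z hzK with h | h
  · exact this.2.1 h
  · exact this.2.2 h

theorem domNum_le {V : Type*} [Fintype V] (G : SimpleGraph V) (D : Finset V)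
    (h : Dominates G ↑D) : domNum G ≤ D.card := Nat.sInf_le ⟨D, rfl, h⟩

theorem domNum_spec {V : Type*} [Fintype V] (G : SimpleGraph V) :
    ∃ D : Finset V, D.card = domNum G ∧ Dominates G ↑D :=
  Nat.sInf_mem (s := {n | ∃ S : Finset V, S.card = n ∧ Dominates G ↑S})
    ⟨_, Finset.univ, rfl, fun v => Or.inl (by simp)⟩

theorem domNum_insert {V : Type*} [Fintype V] [DecidableEq V] (G : SimpleGraph V)
    (A : Finset (Sym2 V)) (e : Sym2 V) :
    domNum (G.deleteEdges (↑(insert e A) : Set (Sym2 V))) ≤ domNum (G.deleteEdges ↑A) + 1 := by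
  obtain ⟨D, hD, hdom⟩ := domNum_spec (G.deleteEdges (↑A : Set (Sym2 V)))
  rw [← hD]
  induction e using Sym2.ind with
  | _ a b =>
  have key : ∀ c, (c = b ∧ a ∈ D ∨ c = a ∧ a ∉ D) →
      Dominates (G.deleteEdges (↑(insert s(a, b) A) : Set (Sym2 V))) ↑(insert c D) := by
    intro c hc v
    rcases hdom v with h | ⟨u, hu, huv⟩
    · left; simp at h ⊢; exact Or.inr h
    · have huD : u ∈ D := by simpa using hu
      rw [SimpleGraph.deleteEdges_adj] at huv
      by_cases he : s(u, v) = s(a, b)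
      · left
        rw [Sym2.eq_iff] at he
        simp only [Finset.coe_insert, Set.mem_insert_iff, Finset.mem_coe]
        rcases he with ⟨rfl, rfl⟩ | ⟨rfl, rfl⟩
        · rcases hc with ⟨h, _⟩ | ⟨_, h⟩
          · exact Or.inl h.symm
          · exact absurd huD h
        · rcases hc with ⟨_, h⟩ | ⟨h, _⟩
          · exact Or.inr h
          · exact Or.inl h.symm
      · right
        refine ⟨u, by simp [huD], ?_⟩
        rw [SimpleGraph.deleteEdges_adj]
        refine ⟨huv.1, ?_⟩
        have := huv.2
        simp only [Finset.coe_insert, Set.mem_insert_iff, not_or]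
        exact ⟨he, this⟩
  by_cases h : a ∈ D
  · exact (domNum_le _ _ (key b (Or.inl ⟨rfl, h⟩))).trans (Finset.card_insert_le _ _)
  · exact (domNum_le _ _ (key a (Or.inr ⟨rfl, h⟩))).trans (Finset.card_insert_le _ _)

theorem bondage_le_of {V : Type*} [Fintype V] (G : SimpleGraph V) (m : ℕ) (A : Finset (Sym2 V))
    (hA : ↑A ⊆ G.edgeSet) (hm : A.card ≤ m)
    (h : domNum G < domNum (G.deleteEdges (↑A : Set (Sym2 V)))) : bondageNum G ≤ m := by
  classical
  induction A using Finset.induction_on with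
  | empty => simp at h
  | insert e A he ih =>
    by_cases h2 : domNum G < domNum (G.deleteEdges (↑A : Set (Sym2 V)))
    · refine ih (fun x hx => hA ?_) ((Finset.card_le_card (Finset.subset_insert _ _)).trans hm) h2
      simp at hx ⊢; exact Or.inr hx
    · have h3 := domNum_insert G A e
      refine le_trans (Nat.sInf_le ⟨insert e A, hA, rfl, ?_⟩) hm
      omega

theorem bondage_pair {V : Type*} [Fintype V] (G : SimpleGraph V) (hplanar : G.CliqueFree 5)
    (u v : V) (huv : u ≠ v)
    (hT : ∀ a b, (G.Adj u a ∨ G.Adj v a) → a ≠ u → (G.Adj u b ∨ G.Adj v b) → b ≠ u → a ≠ b →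
      G.Adj a b)
    (hw : G.Adj u v ∨ ∃ w, G.Adj u w ∧ G.Adj v w) : bondageNum G ≤ 4 := by
  classical
  let T : Finset V := Finset.univ.filter (fun a => (G.Adj u a ∨ G.Adj v a) ∧ a ≠ u)
  have memT : ∀ a, a ∈ T ↔ (G.Adj u a ∨ G.Adj v a) ∧ a ≠ u := fun a => by simp [T]
  have hTc : T.card ≤ 4 := by
    by_contra hc
    obtain ⟨R, hRT, hR⟩ := Finset.exists_subset_card_eq (show 5 ≤ T.card by omega)
    refine hplanar R ⟨?_, hR⟩
    intro a ha b hb hab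
    have ha' := (memT a).1 (hRT ha)
    have hb' := (memT b).1 (hRT hb)
    exact hT a b ha'.1 ha'.2 hb'.1 hb'.2 hab
  let A : Finset (Sym2 V) := T.image (fun t => if G.Adj u t then s(u, t) else s(v, t))
  have hAe : (↑A : Set (Sym2 V)) ⊆ G.edgeSet := by
    intro e he
    simp only [A, Finset.coe_image, Set.mem_image, Finset.mem_coe] at he
    obtain ⟨t, ht, rfl⟩ := he
    have := (memT t).1 ht
    split_ifs with h
    · exact h
    · exact this.1.resolve_left h
  have hu : ∀ t, ¬ (G.deleteEdges (↑A : Set (Sym2 V))).Adj u t := by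
    intro t ht
    rw [SimpleGraph.deleteEdges_adj] at ht
    apply ht.2
    simp only [A, Finset.coe_image, Set.mem_image, Finset.mem_coe]
    exact ⟨t, (memT t).2 ⟨Or.inl ht.1, ht.1.ne'⟩, by rw [if_pos ht.1]⟩
  have hv : ∀ t, (G.deleteEdges (↑A : Set (Sym2 V))).Adj v t → G.Adj u t ∧ G.Adj v t := by
    intro t ht
    have htu : t ≠ u := by
      rintro rfl
      exact hu v ht.symm
    rw [SimpleGraph.deleteEdges_adj] at ht
    refine ⟨?_, ht.1⟩
    by_contra hn
    apply ht.2
    simp only [A, Finset.coe_image, Set.mem_image, Finset.mem_coe]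
    exact ⟨t, (memT t).2 ⟨Or.inr ht.1, htu⟩, by rw [if_neg hn]⟩
  refine bondage_le_of G 4 A hAe (Finset.card_image_le.trans hTc) ?_
  obtain ⟨D, hD, hdom⟩ := domNum_spec (G.deleteEdges (↑A : Set (Sym2 V)))
  rw [← hD]
  have huD : u ∈ D := by
    rcases hdom u with h | ⟨y, _, hy⟩
    · simpa using h
    · exact absurd hy.symm (hu y)
  -- the simple case: a neighbour of `u` is in `D`
  have simple : ∀ y ∈ D, G.Adj u y → domNum G < D.card := by
    intro y hy huy
    refine lt_of_le_of_lt (domNum_le G (D.erase u) ?_) (Finset.card_erase_lt_of_mem huD)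
    intro a
    by_cases hau : a = u
    · right
      exact ⟨y, by simp [hy, huy.ne'], hau ▸ huy.symm⟩
    rcases hdom a with h | ⟨b, hb, hba⟩
    · left; simpa [hau] using h
    · right
      have hbu : b ≠ u := by
        rintro rfl
        exact hu a hba
      exact ⟨b, by simpa [hbu] using hb, (SimpleGraph.deleteEdges_adj.1 hba).1⟩
  rcases hdom v with h | ⟨y, hy, hyv⟩
  · have hvD : v ∈ D := by simpa using h
    rcases hw with hw | ⟨w, huw, hvw⟩
    · exact simple v hvD hw
    · have hvE : v ∈ D.erase u := Finset.mem_erase.2 ⟨huv.symm, hvD⟩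
      have hc1 := Finset.card_erase_lt_of_mem huD
      have hc2 := Finset.card_erase_lt_of_mem hvE
      have hc3 := Finset.card_insert_le w ((D.erase u).erase v)
      refine lt_of_le_of_lt (domNum_le G (insert w ((D.erase u).erase v)) ?_) (by omega)
      intro a
      by_cases haw : a = w
      · left; simp [haw]
      by_cases hau : a = u
      · right; exact ⟨w, by simp, hau ▸ huw.symm⟩
      by_cases hav : a = v
      · right; exact ⟨w, by simp, hav ▸ hvw.symm⟩
      rcases hdom a with h | ⟨b, hb, hba⟩
      · left
        have : a ∈ D := by simpa using h
        simp [this, hau, hav]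
      · right
        have hbD : b ∈ D := by simpa using hb
        have hbu : b ≠ u := by
          rintro rfl
          exact hu a hba
        by_cases hbv : b = v
        · subst hbv
          have := hv a hba
          exact ⟨w, by simp, hT w a (Or.inl huw) huw.ne' (Or.inl this.1) hau (Ne.symm haw)⟩
        · exact ⟨b, by simp [hbD, hbu, hbv], (SimpleGraph.deleteEdges_adj.1 hba).1⟩
  · exact simple y (by simpa using hy) (hv y hyv.symm).1

/-- a planar (hence `K₅`-free) chordal non-complete graph has `b(G) ≤ 4`. -/
theorem bondage_planar_chordal (V : Type*) [Fintype V] (G : SimpleGraph V)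
    (hch : Chordal G) (hplanar : G.CliqueFree 5) (hnc : G ≠ ⊤) :
    bondageNum G ≤ 4 := by
  classical
  by_cases htw : ∃ u v, G.Adj u v ∧ SimplV G u ∧ SimplV G v
  · obtain ⟨u, v, huv, hu, hv⟩ := htw
    have hN : ∀ a, (G.Adj u a ∨ G.Adj v a) → a ≠ u → G.Adj u a := by
      rintro a (h | h) hau
      · exact h
      · exact (hv a u h huv.symm hau).symm
    exact bondage_pair G hplanar u v huv.ne
      (fun a b ha hau hb hbu hab => hu a b (hN a ha hau) (hN b hb hbu) hab) (Or.inl huv)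
  push Not at htw
  by_cases hW : ∃ c, ¬ SimplV G c
  · obtain ⟨c, hc⟩ := hW
    obtain ⟨v, hvW, -, hvs⟩ := dirac G hch _ (Finset.univ.filter (fun c => ¬ SimplV G c)) ∅ rfl
      (by simp) ⟨c, by simp [hc]⟩ (by simp)
    simp only [Finset.mem_filter, Finset.mem_univ, true_and] at hvW hvs
    have hu : ∃ u, G.Adj v u ∧ SimplV G u := by
      by_contra hno
      push Not at hno
      exact hvW (fun a b ha hb hab => hvs a (hno a ha) b (hno b hb) ha hb hab)
    obtain ⟨u, hvu, hus⟩ := hu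
    -- membership in the clique Q
    have hQ : ∀ a b, (a = v ∨ (G.Adj v a ∧ ¬ SimplV G a)) → (b = v ∨ (G.Adj v b ∧ ¬ SimplV G b)) →
        a ≠ b → G.Adj a b := by
      rintro a b (rfl | ⟨ha, ha'⟩) (rfl | ⟨hb, hb'⟩) hab
      · exact absurd rfl hab
      · exact hb
      · exact ha.symm
      · exact hvs a ha' b hb' ha hb hab
    have hNQ : ∀ z, G.Adj v z → SimplV G z → ∀ a, G.Adj z a →
        (a = v ∨ (G.Adj v a ∧ ¬ SimplV G a)) := by
      intro z hvz hz a hza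
      by_cases hav : a = v
      · exact Or.inl hav
      · exact Or.inr ⟨hz v a hvz.symm hza (Ne.symm hav), htw z a hza hz⟩
    by_cases h2 : ∃ u', u' ≠ u ∧ G.Adj v u' ∧ SimplV G u'
    · obtain ⟨u', hne, hvu', hus'⟩ := h2
      have hN : ∀ a, (G.Adj u a ∨ G.Adj u' a) → (a = v ∨ (G.Adj v a ∧ ¬ SimplV G a)) := by
        rintro a (h | h)
        · exact hNQ u hvu hus a h
        · exact hNQ u' hvu' hus' a h
      exact bondage_pair G hplanar u u' hne.symm
        (fun a b ha _ hb _ hab => hQ a b (hN a ha) (hN b hb) hab)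
        (Or.inr ⟨v, hvu.symm, hvu'.symm⟩)
    · push Not at h2
      have hN : ∀ a, (G.Adj u a ∨ G.Adj v a) → a ≠ u → (a = v ∨ (G.Adj v a ∧ ¬ SimplV G a)) := by
        rintro a (h | h) hau
        · exact hNQ u hvu hus a h
        · exact Or.inr ⟨h, h2 a hau h⟩
      exact bondage_pair G hplanar u v hvu.ne'
        (fun a b ha hau hb hbu hab => hQ a b (hN a ha hau) (hN b hb hbu) hab)
        (Or.inl hvu.symm)
  · push Not at hW
    have hE : ∀ a b, ¬ G.Adj a b := fun a b h => htw a b h (hW a) (hW b)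
    have hempty : {n | ∃ A : Finset (Sym2 V), ↑A ⊆ G.edgeSet ∧ A.card = n ∧
        domNum (G.deleteEdges ↑A) = domNum G + 1} = ∅ := by
      rw [Set.eq_empty_iff_forall_notMem]
      rintro n ⟨A, -, -, hA⟩
      have : G.deleteEdges (↑A : Set (Sym2 V)) = G := by
        ext a b
        rw [SimpleGraph.deleteEdges_adj]
        exact ⟨fun h => h.1, fun h => absurd h (hE a b)⟩
      rw [this] at hA
      omega
    unfold bondageNum
    rw [hempty]
    simp
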